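/- Let 0 → (A_n) → (B_n) → (C_n) → 0 be a short exact sequence of inverse systems of abelian groups indexed by ℕ such that every C_n is a finite group and every connecting homomorphism C_{n+1} → C_n is injective. Then (B_n) has the Mittag-Leffler property if and only if (A_n) has the Mittag-Leffler property. -/

import Mathlib

/-- Transition map of an inverse system `(S n, f n)` indexed by `ℕ`:
for `m ≤ n`, the composite `S n → S m` of the connecting maps. -/
def InverseSystem.trans {S : ℕ → Type*} (f : ∀ n, S (n + 1) → S n) :
    ∀ {m n : ℕ}, m ≤ n → S n → S m :=
  fun {m n} h => Nat.leRecOn (C := fun k => S k → S m) h (fun g x => g (f _ x)) id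

/-- The Mittag-Leffler property for an inverse system of sets indexed by `ℕ`. -/
def InverseSystem.IsMittagLeffler {S : ℕ → Type*} (f : ∀ n, S (n + 1) → S n) : Prop :=
  ∀ m : ℕ, ∃ N : ℕ, ∃ hmN : m ≤ N, ∀ n : ℕ, ∀ hNn : N ≤ n,
    Set.range (InverseSystem.trans f (hmN.trans hNn)) = Set.range (InverseSystem.trans f hmN)

namespace InverseSystem

section Sets

variable {S T : ℕ → Type*} {f : ∀ n, S (n + 1) → S n} {g : ∀ n, T (n + 1) → T n}

theorem trans_self (m : ℕ) (x : S m) : trans f le_rfl x = x := by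
  simp [trans, Nat.leRecOn_self]

theorem trans_succ {m n : ℕ} (h : m ≤ n) (x : S (n + 1)) :
    trans f (Nat.le_succ_of_le h) x = trans f h (f n x) := by
  unfold trans
  rw [Nat.leRecOn_succ h]

theorem trans_trans {k m n : ℕ} (hkm : k ≤ m) (hmn : m ≤ n) (x : S n) :
    trans f hkm (trans f hmn x) = trans f (hkm.trans hmn) x := by
  induction n, hmn using Nat.le_induction with
  | base => rw [trans_self]
  | succ n hmn ih => rw [trans_succ hmn, trans_succ (hkm.trans hmn), ih]

/-- Levelwise maps commuting with the connecting maps commute with the transition maps. -/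
theorem map_trans (φ : ∀ n, S n → T n) (hφ : ∀ n x, φ n (f n x) = g n (φ (n + 1) x))
    {m n : ℕ} (h : m ≤ n) (x : S n) : φ m (trans f h x) = trans g h (φ n x) := by
  induction n, h using Nat.le_induction with
  | base => rw [trans_self, trans_self]
  | succ n h ih => rw [trans_succ h, trans_succ h, ih, hφ]

theorem trans_injective (hf : ∀ n, Function.Injective (f n)) {m n : ℕ} (h : m ≤ n) :
    Function.Injective (trans f h) := by
  induction n, h using Nat.le_induction with
  | base => exact fun x y hxy => by simpa only [trans_self] using hxy
  | succ n h ih => exact fun x y hxy => hf n (ih (by simpa only [trans_succ h] using hxy))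

theorem range_trans_subset {k m n : ℕ} (hkm : k ≤ m) (hmn : m ≤ n) :
    Set.range (trans f (hkm.trans hmn)) ⊆ Set.range (trans f hkm) := by
  rintro _ ⟨x, rfl⟩
  exact ⟨trans f hmn x, trans_trans hkm hmn x⟩

/-- An inverse system of finite sets with injective connecting maps is eventually constant. -/
theorem exists_forall_trans_surjective [∀ n, Finite (S n)]
    (hf : ∀ n, Function.Injective (f n)) :
    ∃ K : ℕ, ∀ m n : ℕ, K ≤ m → ∀ h : m ≤ n, Function.Surjective (trans f h) := by
  let K := Function.argmin fun n => Nat.card (S n)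
  refine ⟨K, fun m n hKm hmn => ?_⟩
  have hcard : Nat.card (S m) ≤ Nat.card (S n) :=
    (Nat.card_le_card_of_injective _ (trans_injective hf hKm)).trans
      (Function.argmin_le (fun n => Nat.card (S n)) n)
  exact ((trans_injective hf hmn).bijective_of_nat_card_le hcard).surjective

end Sets

theorem trans_add {S : ℕ → Type*} [∀ n, AddCommGroup (S n)] (f : ∀ n, S (n + 1) →+ S n)
    {m n : ℕ} (h : m ≤ n) (x y : S n) :
    trans (fun n => f n) h (x + y) = trans (fun n => f n) h x + trans (fun n => f n) h y := by
  induction n, h using Nat.le_induction with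
  | base => simp only [trans_self]
  | succ n h ih => simp only [trans_succ h, map_add, ih]

end InverseSystem

/-- let `0 → (A n) → (B n) → (C n) → 0` be a short exact sequence
of inverse systems of abelian groups indexed by `ℕ` such that every `C n` is a
finite group and every connecting homomorphism `C (n+1) → C n` is injective.
Then `(B n)` has the Mittag-Leffler property iff `(A n)` does. -/
theorem mittagLeffler_iff_of_finite_quotients (A B C : ℕ → Type*)
    [∀ n, AddCommGroup (A n)] [∀ n, AddCommGroup (B n)] [∀ n, AddCommGroup (C n)]
    [∀ n, Finite (C n)]
    (fA : ∀ n, A (n + 1) →+ A n) (fB : ∀ n, B (n + 1) →+ B n) (fC : ∀ n, C (n + 1) →+ C n)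
    (ι : ∀ n, A n →+ B n) (π : ∀ n, B n →+ C n)
    (hinj : ∀ n, Function.Injective (ι n))
    (hsurj : ∀ n, Function.Surjective (π n))
    (hexact : ∀ n, (ι n).range = (π n).ker)
    (hcommι : ∀ n (a : A (n + 1)), ι n (fA n a) = fB n (ι (n + 1) a))
    (hcommπ : ∀ n (b : B (n + 1)), π n (fB n b) = fC n (π (n + 1) b))
    (hCinj : ∀ n, Function.Injective (fC n)) :
    InverseSystem.IsMittagLeffler (fun n => (fB n : B (n + 1) → B n)) ↔
      InverseSystem.IsMittagLeffler (fun n => (fA n : A (n + 1) → A n)) := by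
  have hι : ∀ {m n : ℕ} (h : m ≤ n) (a : A n), _ := InverseSystem.map_trans
    (f := fun n => fA n) (g := fun n => fB n) (fun n => ι n) hcommι
  have hπ : ∀ {m n : ℕ} (h : m ≤ n) (b : B n), _ := InverseSystem.map_trans
    (f := fun n => fB n) (g := fun n => fC n) (fun n => π n) hcommπ
  have hker : ∀ n b, π n b = 0 → ∃ a, ι n a = b := fun n b hb =>
    AddMonoidHom.mem_range.1 (hexact n ▸ hb : b ∈ (ι n).range)
  have hπι : ∀ n a, π n (ι n a) = 0 := fun n a =>
    (hexact n ▸ ⟨a, rfl⟩ : ι n a ∈ (π n).ker)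
  constructor
  · intro hB m
    obtain ⟨N, hmN, hN⟩ := hB m
    refine ⟨N, hmN, fun n hNn => (InverseSystem.range_trans_subset hmN hNn).antisymm ?_⟩
    rintro _ ⟨a, rfl⟩
    obtain ⟨b, hb⟩ := (hN n hNn).ge ⟨ι N a, rfl⟩
    have hb0 : π n b = 0 := by
      apply InverseSystem.trans_injective hCinj (hmN.trans hNn)
      rw [← hπ, hb, ← hι, hπι, ← hπι n 0, ← hπ, ← hι, hπι]
    obtain ⟨a', rfl⟩ := hker n b hb0
    refine ⟨a', hinj m ?_⟩
    rw [hι, hι, hb]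
  · intro hA m
    obtain ⟨M, hmM, hM⟩ := hA m
    obtain ⟨K, hK⟩ := InverseSystem.exists_forall_trans_surjective hCinj
    have hMN : M ≤ max M K := le_max_left M K
    have hmN : m ≤ max M K := hmM.trans hMN
    refine ⟨max M K, hmN, fun n hNn => (InverseSystem.range_trans_subset hmN hNn).antisymm ?_⟩
    rintro _ ⟨b, rfl⟩
    obtain ⟨c, hc⟩ := hK _ n (le_max_right M K) hNn (π _ b)
    obtain ⟨b', rfl⟩ := hsurj n c
    obtain ⟨a, ha⟩ := hker _ (b - InverseSystem.trans (fun n => fB n) hNn b') (by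
      rw [map_sub, hπ, hc, sub_self])
    obtain ⟨a', ha'⟩ := ((hM n (hMN.trans hNn)).trans (hM _ hMN).symm).ge ⟨a, rfl⟩
    refine ⟨b' + ι n a', ?_⟩
    rw [InverseSystem.trans_add, ← hι, ha', hι, ha, ← InverseSystem.trans_trans hmN hNn,
      ← InverseSystem.trans_add, add_sub_cancel]
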